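/- Let r₀ ∈ (−1, 1) and v₀ ∈ ℝ. Define r(t) = tanh(t + artanh r₀) and v(t) = (1 / (cosh(t)·(1 + tanh(t)·r₀)))·v₀. Then r(0) = r₀, v(0) = v₀, and for every t ∈ ℝ: r is differentiable at t with r′(t) = 1 − r(t)², and v is differentiable at t with v′(t) = −r(t)·v(t). -/

import Mathlib

/-- The real inverse hyperbolic tangent, `artanh x = (1/2) log((1+x)/(1-x))`. -/
noncomputable def artanh (x : ℝ) : ℝ := (1 / 2) * Real.log ((1 + x) / (1 - x))

theorem tanh_artanh_of_mem_Ioo {x : ℝ} (hx : x ∈ Set.Ioo (-1 : ℝ) 1) :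
    Real.tanh (artanh x) = x := by
  rw [artanh, ← Real.artanh_eq_half_log (Set.Ioo_subset_Icc_self hx), Real.tanh_artanh hx]

theorem hasDerivAt_real_tanh (x : ℝ) : HasDerivAt Real.tanh (1 - Real.tanh x ^ 2) x := by
  have hc := (Real.cosh_pos x).ne'
  have h := (Real.hasDerivAt_sinh x).div (Real.hasDerivAt_cosh x) hc
  have hfun : Real.tanh = Real.sinh / Real.cosh := funext Real.tanh_eq_sinh_div_cosh
  rw [← hfun] at h
  refine h.congr_deriv ?_
  rw [Real.tanh_eq_sinh_div_cosh]
  field_simp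

theorem cosh_mul_one_add_tanh_mul_tanh (t a : ℝ) :
    Real.cosh t * (1 + Real.tanh t * Real.tanh a) = Real.cosh (t + a) / Real.cosh a := by
  have ht := (Real.cosh_pos t).ne'
  have ha := (Real.cosh_pos a).ne'
  rw [Real.tanh_eq_sinh_div_cosh, Real.tanh_eq_sinh_div_cosh, Real.cosh_add]
  field_simp

theorem exact_solution_r11_r21
    (r₀ : ℝ) (hr₀ : r₀ ∈ Set.Ioo (-1 : ℝ) 1) (v₀ : ℝ)
    (r v : ℝ → ℝ)
    (hr : ∀ t, r t = Real.tanh (t + artanh r₀))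
    (hv : ∀ t, v t = (1 / (Real.cosh t * (1 + Real.tanh t * r₀))) * v₀) :
    r 0 = r₀ ∧ v 0 = v₀ ∧
      (∀ t : ℝ, HasDerivAt r (1 - r t ^ 2) t) ∧
      (∀ t : ℝ, HasDerivAt v (-(r t * v t)) t) := by
  have htanh := tanh_artanh_of_mem_Ioo hr₀
  set a := artanh r₀
  obtain rfl : r = fun t => Real.tanh (t + a) := funext hr
  obtain rfl : v = fun t => Real.cosh a / Real.cosh (t + a) * v₀ := by
    funext t
    rw [hv, ← htanh, cosh_mul_one_add_tanh_mul_tanh, one_div_div]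
  have hcosh (t : ℝ) : Real.cosh (t + a) ≠ 0 := (Real.cosh_pos _).ne'
  refine ⟨by simpa using htanh, ?_, fun t => (hasDerivAt_real_tanh (t + a)).comp_add_const t a,
    fun t => ?_⟩
  · simp [(Real.cosh_pos a).ne']
  · have h := (((hasDerivAt_const t (Real.cosh a)).div
      ((Real.hasDerivAt_cosh (t + a)).comp_add_const t a) (hcosh t)).mul_const v₀)
    refine h.congr_deriv ?_
    have := hcosh t
    simp only [Real.tanh_eq_sinh_div_cosh]
    field_simp
    ring
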